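/- For every integer t with 2 ≤ t ≤ 5, the intersection of the systems of sets of lengths 𝓛(H), taken over all numerical monoids H having exactly t atoms, equals { {0}, {1}, {2}, {3} }. -/

import Mathlib

/-- A numerical monoid: an additive submonoid of `ℕ` whose complement in `ℕ` is finite. -/
def IsNumericalMonoid (H : AddSubmonoid ℕ) : Prop :=
  ((H : Set ℕ)ᶜ).Finite

/-- `u` is an atom of `H`: it is a nonzero element of `H` which cannot be written as the
sum of two nonzero elements of `H`. -/
def IsAtomOf (H : AddSubmonoid ℕ) (u : ℕ) : Prop :=
  u ∈ H ∧ u ≠ 0 ∧ ∀ x y : ℕ, x ∈ H → y ∈ H → x ≠ 0 → y ≠ 0 → u ≠ x + y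

/-- The set of atoms of `H`. -/
def atomSet (H : AddSubmonoid ℕ) : Set ℕ := {u | IsAtomOf H u}

/-- The set of lengths of `a`: all `k` such that `a` is a sum of `k` atoms of `H`.
(For `a = 0` this gives `{0}`, via the empty sum, matching the convention `L(0) = {0}`.) -/
def lengthSet (H : AddSubmonoid ℕ) (a : ℕ) : Set ℕ :=
  {k | ∃ s : Multiset ℕ, Multiset.card s = k ∧ (∀ u ∈ s, IsAtomOf H u) ∧ s.sum = a}

/-- The system of sets of lengths of `H`. -/
def systemOfLengths (H : AddSubmonoid ℕ) : Set (Set ℕ) :=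
  {L | ∃ a ∈ H, L = lengthSet H a}

/-- `x` is a sum of two elements of `{b, c, d, e}`. -/
def IsPairSum (b c d e x : ℕ) : Prop :=
  x = b + b ∨ x = b + c ∨ x = b + d ∨ x = b + e ∨ x = c + c ∨ x = c + d ∨ x = c + e ∨
    x = d + d ∨ x = d + e ∨ x = e + e

/-- If all generators are below `2 * a`, then `2 * a + e` is not a sum of two generators. -/
lemma not_isPairSum {a b c d e : ℕ} (hbc : b ≤ c) (hcd : c ≤ d) (hde : d ≤ e) (h2 : e < 2 * a) :
    ¬ IsPairSum b c d e (2 * a + e) := by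
  unfold IsPairSum
  omega

/-- If exactly the largest generator `e` exceeds `2 * a`, then `2 * a + e` is too small to contain
three generators other than `a`. -/
lemma lt_of_isPairSum_of_lt {a b c d e : ℕ} (hab : a < b) (hbc : b ≤ c) (hcd : c ≤ d)
    (hd : d < 2 * a) (he : 2 * a < e) (hac : e ≠ a + c)
    (Ha : IsPairSum b c d e (3 * a)) (Hb : IsPairSum b c d e (2 * a + b))
    (Hc : IsPairSum b c d e (2 * a + c)) (Hd : IsPairSum b c d e (2 * a + d)) :
    a + e < 3 * b := by
  unfold IsPairSum at *
  replace Hd : 2 * a + d = b + e ∨ 2 * a + d = c + e := by clear Ha Hb Hc; omega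
  replace Hc : 2 * a + c = b + e ∨ 2 * a + c = d + d := by clear Ha Hb; omega
  replace Hb : 2 * a + b = c + c ∨ 2 * a + b = c + d ∨ 2 * a + b = d + d := by
    clear Ha Hc; omega
  replace Ha : 3 * a = b + b ∨ 3 * a = b + c ∨ 3 * a = b + d ∨ 3 * a = c + c ∨
    3 * a = c + d := by clear Hc; omega
  by_contra!
  rcases Hd with Hd | Hd <;> rcases Hc with Hc | Hc <;> rcases Hb with Hb | Hb | Hb <;> omega

/-- If at least two generators exceed `2 * a`, then not every `2 * a + n` below `5 * a` has a
factorization whose length is not three. -/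
lemma false_of_two_mul_lt {a b c d e : ℕ} (hab : a < b) (hbc : b ≤ c)
    (hc : c < 2 * a) (hd : 2 * a < d) (hde : d ≤ e)
    (hab' : e ≠ a + b) (hac : e ≠ a + c) (hbc' : e ≠ b + c) (hbb : e ≠ b + b) (hcc : e ≠ c + c)
    (Ha : IsPairSum b c d e (3 * a)) (Hb : IsPairSum b c d e (2 * a + b))
    (Hc : IsPairSum b c d e (2 * a + c))
    (Hd : IsPairSum b c d e (2 * a + d) ∨ a + 3 * b ≤ 2 * a + d ∨ 5 * a ≤ 2 * a + d)
    (He : IsPairSum b c d e (2 * a + e) ∨ a + 3 * b ≤ 2 * a + e ∨ 5 * a ≤ 2 * a + e) :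
    False := by
  unfold IsPairSum at *
  replace Hb : 2 * a + b = c + c := by clear Ha Hc Hd He; omega
  replace Ha : 3 * a = b + b ∨ 3 * a = b + c := by clear Hc Hd He; omega
  replace Hc : 2 * a + c = b + d ∨ 2 * a + c = b + e := by clear Hd He; omega
  rcases Hd with Hd | Hd
  · rcases He with He | He
    · omega
    · omega
  · clear He; omega

lemma IsAtomOf.ne_add {H : AddSubmonoid ℕ} {u x y : ℕ} (hu : IsAtomOf H u) (hx : IsAtomOf H x)
    (hy : IsAtomOf H y) : u ≠ x + y :=
  hu.2.2 x y hx.1 hy.1 hx.2.1 hy.2.1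

lemma mul_le_of_mem_lengthSet {H : AddSubmonoid ℕ} {a k x : ℕ} (hmin : ∀ u, IsAtomOf H u → a ≤ u)
    (hk : k ∈ lengthSet H x) : k * a ≤ x := by
  obtain ⟨s, rfl, hs, rfl⟩ := hk
  simpa using Multiset.card_nsmul_le_sum fun u hu => hmin u (hs u hu)

lemma lengthSet_zero (H : AddSubmonoid ℕ) : lengthSet H 0 = {0} := by
  ext k
  constructor
  · intro hk
    have := mul_le_of_mem_lengthSet (a := 1) (fun u hu => Nat.one_le_iff_ne_zero.2 hu.2.1) hk
    simp only [Set.mem_singleton_iff]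
    omega
  · rintro rfl
    exact ⟨0, by simp⟩

lemma eq_zero_of_zero_mem_lengthSet {H : AddSubmonoid ℕ} {x : ℕ} (h : 0 ∈ lengthSet H x) :
    x = 0 := by
  obtain ⟨s, hs, -, rfl⟩ := h
  simp [Multiset.card_eq_zero.1 hs]

lemma isAtomOf_of_one_mem_lengthSet {H : AddSubmonoid ℕ} {x : ℕ} (h : 1 ∈ lengthSet H x) :
    IsAtomOf H x := by
  obtain ⟨s, hs, hs', rfl⟩ := h
  obtain ⟨u, rfl⟩ := Multiset.card_eq_one.1 hs
  simpa using hs'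

lemma lengthSet_atom {H : AddSubmonoid ℕ} {u : ℕ} (hu : IsAtomOf H u) : lengthSet H u = {1} := by
  ext k
  constructor
  · rintro ⟨s, rfl, hs, hsum⟩
    induction s using Multiset.induction with
    | empty => exact absurd hsum.symm hu.2.1
    | cons v s ih =>
      have hsH : s.sum ∈ H := H.multiset_sum_mem s fun w hw => (hs w (by simp [hw])).1
      have hv := hs v (by simp)
      have hs0 : s.sum = 0 := by
        by_contra h0
        exact hu.2.2 v s.sum hv.1 hsH hv.2.1 h0 (by simpa using hsum.symm)
      have : s = 0 := by
        by_contra hne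
        obtain ⟨w, hw⟩ := Multiset.exists_mem_of_ne_zero hne
        exact (hs w (by simp [hw])).2.1 (Multiset.sum_eq_zero_iff.1 hs0 w hw)
      simp [this]
  · rintro rfl
    exact ⟨{u}, by simpa using hu⟩

lemma lengthSet_two_mul {H : AddSubmonoid ℕ} {a : ℕ} (ha : IsAtomOf H a)
    (hmin : ∀ u, IsAtomOf H u → a ≤ u) : lengthSet H (a + a) = {2} := by
  ext k
  constructor
  · intro hk
    have h0 := Nat.pos_of_ne_zero ha.2.1
    have h := mul_le_of_mem_lengthSet hmin hk
    have hk2 : k ≤ 2 := by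
      by_contra! h3
      have := Nat.mul_le_mul_right a h3
      omega
    interval_cases k
    · have := eq_zero_of_zero_mem_lengthSet hk
      omega
    · exact absurd rfl ((isAtomOf_of_one_mem_lengthSet hk).ne_add ha ha)
    · rfl
  · rintro rfl
    exact ⟨{a, a}, by simpa using ha⟩

lemma factorization_of_lengthSet_ne {H : AddSubmonoid ℕ} {a b n : ℕ} (ha : IsAtomOf H a)
    (hb : ∀ u, IsAtomOf H u → u = a ∨ b ≤ u) (hab : a < b) (hn : IsAtomOf H n)
    (h : lengthSet H (2 * a + n) ≠ {3}) :
    (∃ p q, IsAtomOf H p ∧ IsAtomOf H q ∧ p ≠ a ∧ q ≠ a ∧ 2 * a + n = p + q) ∨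
      a + 3 * b ≤ 2 * a + n ∨ 5 * a ≤ 2 * a + n := by
  have h3 : 3 ∈ lengthSet H (2 * a + n) :=
    ⟨{a, a, n}, by simp, by simp [ha, hn], by simp [two_mul, add_assoc]⟩
  obtain ⟨k, hk, hk3⟩ : ∃ k ∈ lengthSet H (2 * a + n), k ≠ 3 := by
    by_contra! hall
    exact h (Set.eq_singleton_iff_unique_mem.2 ⟨h3, hall⟩)
  have h0 := Nat.pos_of_ne_zero ha.2.1
  have haH : a + n ∈ H := H.add_mem ha.1 hn.1
  by_cases hk5 : 5 ≤ k
  · have := mul_le_of_mem_lengthSet (a := a)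
      (fun u hu => (hb u hu).elim (fun h => h.ge) fun h => by omega) hk
    have := Nat.mul_le_mul_right a hk5
    omega
  obtain rfl | rfl | rfl | rfl : k = 0 ∨ k = 1 ∨ k = 2 ∨ k = 4 := by omega
  · have := eq_zero_of_zero_mem_lengthSet hk
    omega
  · exact absurd (by omega)
      ((isAtomOf_of_one_mem_lengthSet hk).2.2 a (a + n) ha.1 haH (by omega) (by omega))
  · obtain ⟨s, hs, hs', hsum⟩ := hk
    obtain ⟨p, q, rfl⟩ := Multiset.card_eq_two.1 hs
    simp only [Multiset.insert_eq_cons, Multiset.mem_cons, Multiset.mem_singleton,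
      forall_eq_or_imp, forall_eq, Multiset.sum_cons, Multiset.sum_singleton] at hs' hsum
    obtain ⟨hp, hq⟩ := hs'
    have := hp.ne_add ha hn
    have := hq.ne_add ha hn
    exact Or.inl ⟨p, q, hp, hq, by omega, by omega, by omega⟩
  · obtain ⟨s, hs, hs', hsum⟩ := hk
    obtain ⟨p, s, rfl⟩ := Multiset.card_pos_iff_exists_mem.1 (by omega : 0 < s.card) |>.imp
      fun p hp => Multiset.exists_cons_of_mem hp
    obtain ⟨q, r, t, rfl⟩ := Multiset.card_eq_three.1 (by simpa using hs : s.card = 3)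
    simp only [Multiset.insert_eq_cons, Multiset.mem_cons, Multiset.mem_singleton,
      forall_eq_or_imp, forall_eq, Multiset.sum_cons, Multiset.sum_singleton] at hs' hsum
    obtain ⟨hp, hq, hr, ht⟩ := hs'
    have := hn.ne_add hp hq
    have := hn.ne_add hp hr
    have := hn.ne_add hp ht
    have := hn.ne_add hq hr
    have := hn.ne_add hq ht
    have := hn.ne_add hr ht
    have := hb p hp
    have := hb q hq
    have := hb r hr
    have := hb t ht
    omega

lemma exists_lengthSet_eq_three {H : AddSubmonoid ℕ} {a b c d e : ℕ}
    (hS : ∀ u, IsAtomOf H u ↔ u = a ∨ u = b ∨ u = c ∨ u = d ∨ u = e)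
    (hab : a < b) (hbc : b ≤ c) (hcd : c ≤ d) (hde : d ≤ e) :
    ∃ x ∈ H, lengthSet H x = {3} := by
  by_contra! hcon
  have ha : IsAtomOf H a := (hS a).2 (by simp)
  have hb : IsAtomOf H b := (hS b).2 (by simp)
  have hc : IsAtomOf H c := (hS c).2 (by simp)
  have hd : IsAtomOf H d := (hS d).2 (by simp)
  have he : IsAtomOf H e := (hS e).2 (by simp)
  have key : ∀ n, IsAtomOf H n →
      IsPairSum b c d e (2 * a + n) ∨ a + 3 * b ≤ 2 * a + n ∨ 5 * a ≤ 2 * a + n := by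
    intro n hn
    refine (factorization_of_lengthSet_ne ha (fun u hu => ?_) hab hn (hcon _ ?_)).imp_left ?_
    · have := (hS u).1 hu
      omega
    · exact H.add_mem (two_mul a ▸ H.add_mem ha.1 ha.1) hn.1
    · rintro ⟨p, q, hp, hq, hpa, hqa, h⟩
      have hp := ((hS p).1 hp).resolve_left hpa
      have hq := ((hS q).1 hq).resolve_left hqa
      unfold IsPairSum
      rcases hp with rfl | rfl | rfl | rfl <;> omega
  have key' : ∀ n, IsAtomOf H n → n < 2 * a → IsPairSum b c d e (2 * a + n) := fun n hn h =>
    (key n hn).resolve_right (by omega)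
  have ne_two : ∀ u, IsAtomOf H u → u ≠ 2 * a := fun u hu => two_mul a ▸ hu.ne_add ha ha
  have hb2 := ne_two b hb
  have hc2 := ne_two c hc
  have hd2 := ne_two d hd
  have he2 := ne_two e he
  have h0 := Nat.pos_of_ne_zero ha.2.1
  have Ha : IsPairSum b c d e (3 * a) := by
    convert key' a ha (by omega) using 1
    ring
  by_cases hlb : 2 * a < b
  · unfold IsPairSum at Ha
    omega
  have Hb := key' b hb (by omega)
  by_cases hlc : 2 * a < c
  · unfold IsPairSum at Hb
    omega
  have Hc := key' c hc (by omega)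
  by_cases hld : 2 * a < d
  · exact false_of_two_mul_lt hab hbc (by omega) hld hde (he.ne_add ha hb) (he.ne_add ha hc)
      (he.ne_add hb hc) (he.ne_add hb hb) (he.ne_add hc hc) Ha Hb Hc (key d hd) (key e he)
  have Hd := key' d hd (by omega)
  by_cases hle : 2 * a < e
  · have := lt_of_isPairSum_of_lt hab hbc hcd (by omega) hle (he.ne_add ha hc) Ha Hb Hc Hd
    have He := key e he
    unfold IsPairSum at Hd He
    clear Ha Hb Hc
    omega
  · exact not_isPairSum hbc hcd hde (by omega) (key' e he (by omega))

lemma exists_sorted_atoms {H : AddSubmonoid ℕ} {t : ℕ} (ht2 : 2 ≤ t) (ht5 : t ≤ 5)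
    (hcard : (atomSet H).ncard = t) : ∃ a b c d e : ℕ,
      (∀ u, IsAtomOf H u ↔ u = a ∨ u = b ∨ u = c ∨ u = d ∨ u = e) ∧
        a < b ∧ b ≤ c ∧ c ≤ d ∧ d ≤ e := by
  have hfin : (atomSet H).Finite := Set.finite_of_ncard_ne_zero (by omega)
  rw [Set.ncard_eq_toFinset_card _ hfin] at hcard
  set f := hfin.toFinset.orderEmbOfFin hcard
  let g : ℕ → ℕ := fun i => f ⟨min i (t - 1), by omega⟩
  refine ⟨g 0, g 1, g 2, g 3, g 4, fun u => ?_, ?_, ?_, ?_, ?_⟩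
  · have hr : IsAtomOf H u ↔ u ∈ Set.range f := by
      simp [f, Finset.range_orderEmbOfFin, atomSet]
    rw [hr]
    constructor
    · rintro ⟨⟨i, hi⟩, rfl⟩
      have hg : f ⟨i, hi⟩ = g i := by
        simp only [g]
        congr
        omega
      rw [hg]
      obtain rfl | rfl | rfl | rfl | rfl : i = 0 ∨ i = 1 ∨ i = 2 ∨ i = 3 ∨ i = 4 := by omega
      all_goals simp
    · rintro (rfl | rfl | rfl | rfl | rfl) <;> exact ⟨_, rfl⟩
  · exact f.strictMono (by simp only [Fin.mk_lt_mk]; omega)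
  all_goals exact f.monotone (by simp only [Fin.mk_le_mk]; omega)

/-- The numerical monoid `{0} ∪ {t, t + 1, …}`, generated by `t, …, 2 * t - 1`. -/
def intervalMonoid (t : ℕ) : AddSubmonoid ℕ where
  carrier := {x | x = 0 ∨ t ≤ x}
  zero_mem' := Or.inl rfl
  add_mem' := by
    intro x y hx hy
    simp only [Set.mem_ofPred_eq] at *
    omega

lemma mem_intervalMonoid {t x : ℕ} : x ∈ intervalMonoid t ↔ x = 0 ∨ t ≤ x := Iff.rfl

lemma isNumericalMonoid_intervalMonoid (t : ℕ) : IsNumericalMonoid (intervalMonoid t) :=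
  (Set.finite_Iio t).subset fun x hx => by
    simp only [Set.mem_compl_iff, SetLike.mem_coe, mem_intervalMonoid] at hx
    simp only [Set.mem_Iio]
    omega

lemma isAtomOf_intervalMonoid {t u : ℕ} (ht : 0 < t) :
    IsAtomOf (intervalMonoid t) u ↔ t ≤ u ∧ u < 2 * t := by
  simp only [IsAtomOf, mem_intervalMonoid]
  constructor
  · rintro ⟨h, h0, hu⟩
    refine ⟨by omega, ?_⟩
    by_contra! h2
    exact hu t (u - t) (by omega) (by omega) (by omega) (by omega) (by omega)
  · rintro ⟨h1, h2⟩
    exact ⟨by omega, by omega, fun x y hx hy hx0 hy0 => by omega⟩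

lemma ncard_atomSet_intervalMonoid {t : ℕ} (ht : 0 < t) :
    (atomSet (intervalMonoid t)).ncard = t := by
  have : atomSet (intervalMonoid t) = ↑(Finset.Ico t (2 * t)) := by
    ext u
    simp [atomSet, isAtomOf_intervalMonoid ht]
  rw [this, Set.ncard_coe_finset, Nat.card_Ico]
  omega

lemma mem_lengthSet_intervalMonoid {t k x : ℕ} (ht : 0 < t) (h1 : k * t ≤ x)
    (h2 : x ≤ k * (2 * t - 1)) : k ∈ lengthSet (intervalMonoid t) x := by
  induction k generalizing x with
  | zero => exact ⟨0, by simp; omega⟩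
  | succ k ih =>
    rw [Nat.succ_mul] at h1 h2
    obtain ⟨u, hu1, hu2, hu3, hu4⟩ : ∃ u, t ≤ u ∧ u ≤ 2 * t - 1 ∧ u + k * t ≤ x ∧
        x ≤ u + k * (2 * t - 1) := by
      rcases le_total (x - k * t) (2 * t - 1) with h | h
      · have : k * t ≤ k * (2 * t - 1) := Nat.mul_le_mul_left k (by omega)
        exact ⟨x - k * t, by omega, h, by omega, by omega⟩
      · exact ⟨2 * t - 1, by omega, le_rfl, by omega, by omega⟩
    obtain ⟨s, hs, hs', hsum⟩ := ih (x := x - u) (by omega) (by omega)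
    refine ⟨u ::ₘ s, by simp [hs], ?_, ?_⟩
    · simp only [Multiset.mem_cons, forall_eq_or_imp]
      exact ⟨(isAtomOf_intervalMonoid ht).2 ⟨hu1, by omega⟩, hs'⟩
    · rw [Multiset.sum_cons, hsum]
      omega

/-- The monoid generated by the arithmetic progression `t, t + d, …, t + (t - 1) * d`. -/
def progressionMonoid (t d : ℕ) : AddSubmonoid ℕ where
  carrier := {x | ∃ k j, j ≤ k * (t - 1) ∧ x = k * t + d * j}
  zero_mem' := ⟨0, 0, by simp⟩
  add_mem' := by
    rintro _ _ ⟨k, j, h, rfl⟩ ⟨k', j', h', rfl⟩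
    exact ⟨k + k', j + j', by rw [add_mul]; omega, by ring⟩

lemma mem_progressionMonoid {t d x : ℕ} :
    x ∈ progressionMonoid t d ↔ ∃ k j, j ≤ k * (t - 1) ∧ x = k * t + d * j := Iff.rfl

lemma isNumericalMonoid_progressionMonoid {t : ℕ} (ht : 0 < t) (m : ℕ) :
    IsNumericalMonoid (progressionMonoid t (t * m + 1)) := by
  refine (Set.finite_Iio (t * (t * m + 2))).subset fun x hx => ?_
  by_contra hlt
  refine hx ?_
  simp only [Set.mem_Iio, not_lt] at hlt
  have hj : x % t < t := Nat.mod_lt x ht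
  have hq : t * m + 2 ≤ x / t := (Nat.le_div_iff_mul_le ht).2 (by linarith)
  have hmj : m * (x % t) ≤ t * m := by
    rw [mul_comm t]
    exact Nat.mul_le_mul_left m hj.le
  obtain ⟨k, hk⟩ := Nat.exists_eq_add_of_le (show m * (x % t) + 1 ≤ x / t by omega)
  refine ⟨k + 1, x % t, ?_, ?_⟩
  · have : 1 * (t - 1) ≤ (k + 1) * (t - 1) := Nat.mul_le_mul_right _ (by omega)
    omega
  · conv_lhs => rw [← Nat.div_add_mod x t, hk]
    ring

lemma isAtomOf_progressionMonoid {t d u : ℕ} (hd : 0 < d) (ht : 0 < t) (htd : Nat.Coprime d t) :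
    IsAtomOf (progressionMonoid t d) u ↔ ∃ j < t, u = t + d * j := by
  constructor
  · rintro ⟨⟨k, j, hj, rfl⟩, h0, hu⟩
    obtain rfl | rfl | hk : k = 0 ∨ k = 1 ∨ 2 ≤ k := by omega
    · simp_all
    · exact ⟨j, by omega, by ring⟩
    · obtain ⟨l, rfl⟩ := Nat.exists_eq_add_of_le' hk
      refine absurd ?_ (hu (1 * t + d * min j (t - 1)) ((l + 1) * t + d * (j - min j (t - 1)))
        ⟨1, _, by simp, rfl⟩ ⟨l + 1, _, ?_, rfl⟩ ?_ ?_)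
      · obtain ⟨i, hi⟩ := Nat.exists_eq_add_of_le (min_le_left j (t - 1))
        have : j - min j (t - 1) = i := by omega
        rw [this]
        conv_lhs => rw [hi]
        ring
      · have h1 : (l + 2) * (t - 1) = (l + 1) * (t - 1) + (t - 1) := by ring
        omega
      · omega
      · have : 0 < (l + 1) * t := Nat.mul_pos l.succ_pos ht
        omega
  · rintro ⟨j, hj, rfl⟩
    refine ⟨⟨1, j, by omega, by ring⟩, by omega, ?_⟩
    rintro _ _ ⟨k, i, hi, rfl⟩ ⟨l, i', hi', rfl⟩ hx hy h
    rcases k with _ | k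
    · simp_all
    rcases l with _ | l
    · simp_all
    have h1 : (k + l + 1) * t + d * (i + i') = d * j := by linarith
    have h2 : d ∣ (k + l + 1) * t := (Nat.dvd_add_left (dvd_mul_right d (i + i'))).1
      (h1 ▸ dvd_mul_right d j)
    have h3 := Nat.le_of_dvd (by omega) (htd.dvd_of_dvd_mul_right h2)
    have h4 : d * t ≤ (k + l + 1) * t := Nat.mul_le_mul_right t h3
    have h5 : d * t ≤ d * j := by omega
    exact absurd (Nat.le_of_mul_le_mul_left h5 hd) (by omega)

lemma ncard_atomSet_progressionMonoid {t d : ℕ} (hd : 0 < d) (ht : 0 < t)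
    (htd : Nat.Coprime d t) : (atomSet (progressionMonoid t d)).ncard = t := by
  have : atomSet (progressionMonoid t d) =
      ↑((Finset.range t).image fun j => t + d * j) := by
    ext u
    simp [atomSet, isAtomOf_progressionMonoid hd ht htd, eq_comm]
  rw [this, Set.ncard_coe_finset, Finset.card_image_of_injective, Finset.card_range]
  intro i j hij
  exact Nat.eq_of_mul_eq_mul_left hd (Nat.add_left_cancel hij)

lemma modEq_of_mem_lengthSet_progressionMonoid {t d k l x : ℕ} (hd : 0 < d) (ht : 0 < t)
    (htd : Nat.Coprime d t) (hk : k ∈ lengthSet (progressionMonoid t d) x)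
    (hl : l ∈ lengthSet (progressionMonoid t d) x) : k ≡ l [MOD d] := by
  have key : ∀ k ∈ lengthSet (progressionMonoid t d) x, k * t ≡ x [MOD d] := by
    clear hk hl
    rintro _ ⟨s, rfl, hs, rfl⟩
    induction s using Multiset.induction with
    | empty => simp [Nat.ModEq.refl]
    | cons u s ih =>
      obtain ⟨j, -, rfl⟩ := (isAtomOf_progressionMonoid hd ht htd).1 (hs u (by simp))
      rw [Multiset.card_cons, Multiset.sum_cons, Nat.succ_mul, add_comm]
      refine Nat.ModEq.add ?_ (ih fun v hv => hs v (by simp [hv]))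
      simp [Nat.ModEq]
  exact Nat.ModEq.cancel_right_of_coprime htd ((key k hk).trans (key l hl).symm)

theorem stmt_2 (t : ℕ) (ht2 : 2 ≤ t) (ht5 : t ≤ 5) :
    (⋂ H ∈ {H : AddSubmonoid ℕ | IsNumericalMonoid H ∧ (atomSet H).ncard = t},
        systemOfLengths H) = {({0} : Set ℕ), {1}, {2}, {3}} := by
  have ht : 0 < t := by omega
  ext L
  simp only [Set.mem_iInter, Set.mem_ofPred_eq, Set.mem_insert_iff, Set.mem_singleton_iff]
  constructor
  · intro hL
    obtain ⟨x, hxH, hLx⟩ := hL (intervalMonoid t)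
      ⟨isNumericalMonoid_intervalMonoid t, ncard_atomSet_intervalMonoid ht⟩
    obtain rfl | hxt := mem_intervalMonoid.1 hxH
    · exact Or.inl (hLx.trans (lengthSet_zero _))
    obtain ⟨k, hx, hx'⟩ : ∃ k, k * t ≤ x ∧ x < (k + 1) * t :=
      ⟨x / t, Nat.div_mul_le_self x t, by
        rw [mul_comm]
        exact Nat.lt_mul_div_succ x ht⟩
    obtain ⟨s, hs⟩ := Nat.exists_eq_add_of_le' ht2
    have hs' : 2 * t - 1 = 2 * s + 3 := by omega
    have hk : k ∈ L := by
      rw [hLx]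
      refine mem_lengthSet_intervalMonoid ht hx ?_
      rcases k with _ | m
      · omega
      · rw [hs']
        rw [hs] at hx'
        nlinarith
    have hLk : L = {k} := by
      refine Set.eq_singleton_iff_unique_mem.2 ⟨hk, fun l hl => ?_⟩
      have hd : 0 < t * (k + l) + 1 := Nat.succ_pos _
      have htd : Nat.Coprime (t * (k + l) + 1) t := by simp
      obtain ⟨y, -, rfl⟩ := hL (progressionMonoid t (t * (k + l) + 1))
        ⟨isNumericalMonoid_progressionMonoid ht _, ncard_atomSet_progressionMonoid hd ht htd⟩
      have := Nat.le_mul_of_pos_left (k + l) ht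
      exact (modEq_of_mem_lengthSet_progressionMonoid hd ht htd hl hk).eq_of_lt_of_lt
        (by omega) (by omega)
    have hk4 : k < 4 := by
      by_contra! h4
      obtain ⟨n, hn⟩ := Nat.exists_eq_add_of_le' h4
      have : n + 3 ∈ L := by
        rw [hn] at hx hx'
        rw [hLx]
        refine mem_lengthSet_intervalMonoid ht (by linarith) ?_
        rw [hs']
        rw [hs] at hx'
        nlinarith
      rw [hLk, Set.mem_singleton_iff] at this
      omega
    interval_cases k <;> simp [hLk]
  · intro hL H hH
    obtain ⟨a, b, c, d, e, hS, hab, hbc, hcd, hde⟩ := exists_sorted_atoms ht2 ht5 hH.2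
    have ha : IsAtomOf H a := (hS a).2 (by simp)
    rcases hL with rfl | rfl | rfl | rfl
    · exact ⟨0, H.zero_mem, (lengthSet_zero H).symm⟩
    · exact ⟨a, ha.1, (lengthSet_atom ha).symm⟩
    · refine ⟨a + a, H.add_mem ha.1 ha.1, (lengthSet_two_mul ha fun u hu => ?_).symm⟩
      have := (hS u).1 hu
      omega
    · obtain ⟨x, hx, h⟩ := exists_lengthSet_eq_three hS hab hbc hcd hde
      exact ⟨x, hx, h.symm⟩
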